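/- arXiv:2403.12716 — 2 statements merged into one kernel-verified Lean document; each statement's English description precedes it below -/
import Mathlib

section
/- Let R be a commutative ring, n : ℕ, h : MvPolynomial (Fin n) R, and a, b, c : Fin n pairwise distinct indices. Define the intermediate-pattern reduction: h₁ = ψ_{a→b, degreeOf b h + 1} h and h₂ = ψ_{b→c, degreeOf c h₁ + 1} h₁. Define the straight-pattern reduction: g₁ = ψ_{b→c, degreeOf c h + 1} h and g₂ = ψ_{a→c, degreeOf c g₁ + 1} g₁. Then degreeOf c g₂ ≤ degreeOf c h₂. -/
open MvPolynomial

/-- Single Kronecker substitution: sends `X i` to `(X j) ^ D` and fixes every other variable. -/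
noncomputable def singleKron (R : Type*) [CommRing R] {n : ℕ} (i j : Fin n) (D : ℕ) :
    MvPolynomial (Fin n) R →ₐ[R] MvPolynomial (Fin n) R :=
  MvPolynomial.aeval (fun m : Fin n =>
    if m = i then (MvPolynomial.X j : MvPolynomial (Fin n) R) ^ D else MvPolynomial.X m)

/-- The action of the substitution `X i ↦ (X j) ^ D` on exponent vectors. -/
noncomputable def kronExponent {σ : Type*} (i j : σ) (D : ℕ) (m : σ →₀ ℕ) : σ →₀ ℕ :=
  m.erase i + Finsupp.single j (D * m i)

theorem kronExponent_apply_target {σ : Type*} {i j : σ} (hij : i ≠ j) (D : ℕ) (m : σ →₀ ℕ) :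
    kronExponent i j D m j = m j + D * m i := by
  simp [kronExponent, Finsupp.erase_ne hij.symm]

theorem kronExponent_apply_of_ne {σ : Type*} {i j k : σ} (hki : k ≠ i) (hkj : k ≠ j) (D : ℕ)
    (m : σ →₀ ℕ) : kronExponent i j D m k = m k := by
  simp [kronExponent, Finsupp.erase_ne hki, Finsupp.single_eq_of_ne hkj]

theorem kronExponent_inj {σ : Type*} {i j : σ} (hij : i ≠ j) {D : ℕ} {m m' : σ →₀ ℕ}
    (hm : m j < D) (hm' : m' j < D) (h : kronExponent i j D m = kronExponent i j D m') :
    m = m' := by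
  have hj := DFunLike.congr_fun h j
  rw [kronExponent_apply_target hij, kronExponent_apply_target hij] at hj
  have hmod : m j = m' j := by
    simpa [Nat.add_mul_mod_self_left, Nat.mod_eq_of_lt hm, Nat.mod_eq_of_lt hm'] using
      congrArg (· % D) hj
  have hi : m i = m' i := by
    rw [hmod] at hj
    exact Nat.eq_of_mul_eq_mul_left (Nat.zero_lt_of_lt hm) (Nat.add_left_cancel hj)
  ext k
  by_cases hki : k = i
  · rw [hki, hi]
  by_cases hkj : k = j
  · rw [hkj, hmod]
  · simpa only [kronExponent_apply_of_ne hki hkj] using DFunLike.congr_fun h k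

theorem singleKron_monomial {R : Type*} [CommRing R] {n : ℕ} (i j : Fin n) (D : ℕ)
    (m : Fin n →₀ ℕ) (r : R) :
    singleKron R i j D (monomial m r) = monomial (kronExponent i j D m) r := by
  have herase : singleKron R i j D (monomial (m.erase i) r) = monomial (m.erase i) r := by
    rw [singleKron, aeval_monomial, monomial_eq, algebraMap_eq]
    congr 1
    refine Finset.prod_congr rfl fun k hk => ?_
    have hki : k ≠ i := by
      rintro rfl
      simp at hk
    simp only [if_neg hki]
  have hsingle : singleKron R i j D (monomial (Finsupp.single i (m i)) 1) =
      monomial (Finsupp.single j (D * m i)) 1 := by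
    rw [← X_pow_eq_monomial, ← X_pow_eq_monomial, map_pow, singleKron, aeval_X, if_pos rfl,
      pow_mul]
  calc singleKron R i j D (monomial m r)
      = singleKron R i j D (monomial (m.erase i) r * monomial (Finsupp.single i (m i)) 1) := by
        rw [monomial_mul, mul_one, Finsupp.erase_add_single]
    _ = monomial (kronExponent i j D m) r := by
        rw [map_mul, herase, hsingle, monomial_mul, mul_one, kronExponent]

theorem singleKron_eq_sum {R : Type*} [CommRing R] {n : ℕ} (i j : Fin n) (D : ℕ)
    (p : MvPolynomial (Fin n) R) :
    singleKron R i j D p = ∑ m ∈ p.support, monomial (kronExponent i j D m) (coeff m p) := by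
  conv_lhs => rw [p.as_sum, map_sum]
  simp only [singleKron_monomial]

theorem exists_of_mem_support_singleKron {R : Type*} [CommRing R] {n : ℕ} {i j : Fin n} {D : ℕ}
    {p : MvPolynomial (Fin n) R} {e : Fin n →₀ ℕ} (he : e ∈ (singleKron R i j D p).support) :
    ∃ m ∈ p.support, kronExponent i j D m = e := by
  classical
  rw [mem_support_iff, singleKron_eq_sum, coeff_sum] at he
  obtain ⟨m, hm, hne⟩ := Finset.exists_ne_zero_of_sum_ne_zero he
  refine ⟨m, hm, ?_⟩
  by_contra h
  exact hne (by rw [coeff_monomial, if_neg h])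

theorem kronExponent_mem_support_singleKron {R : Type*} [CommRing R] {n : ℕ} {i j : Fin n}
    (hij : i ≠ j) {D : ℕ} {p : MvPolynomial (Fin n) R} (hD : p.degreeOf j < D)
    {m : Fin n →₀ ℕ} (hm : m ∈ p.support) :
    kronExponent i j D m ∈ (singleKron R i j D p).support := by
  classical
  have hlt : ∀ k ∈ p.support, k j < D := fun k hk => (monomial_le_degreeOf j hk).trans_lt hD
  rw [mem_support_iff, singleKron_eq_sum, coeff_sum, Finset.sum_eq_single_of_mem m hm,
    coeff_monomial, if_pos rfl]
  · exact mem_support_iff.mp hm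
  · intro k hk hkm
    rw [coeff_monomial, if_neg]
    exact fun h => hkm (kronExponent_inj hij (hlt k hk) (hlt m hm) h)

theorem stmt_11 {R : Type*} [CommRing R] {n : ℕ} (h : MvPolynomial (Fin n) R)
    (a b c : Fin n) (hab : a ≠ b) (hbc : b ≠ c) (hac : a ≠ c)
    (h₁ : MvPolynomial (Fin n) R) (hh₁ : h₁ = singleKron R a b (h.degreeOf b + 1) h)
    (h₂ : MvPolynomial (Fin n) R) (hh₂ : h₂ = singleKron R b c (h₁.degreeOf c + 1) h₁)
    (g₁ : MvPolynomial (Fin n) R) (hg₁ : g₁ = singleKron R b c (h.degreeOf c + 1) h)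
    (g₂ : MvPolynomial (Fin n) R) (hg₂ : g₂ = singleKron R a c (g₁.degreeOf c + 1) g₁) :
    g₂.degreeOf c ≤ h₂.degreeOf c := by
  have mem_h₁ : ∀ m ∈ h.support, kronExponent a b (h.degreeOf b + 1) m ∈ h₁.support :=
    fun m hm => hh₁ ▸ kronExponent_mem_support_singleKron hab (Nat.lt_succ_self _) hm
  have hC : h.degreeOf c ≤ h₁.degreeOf c := by
    refine degreeOf_le_iff.mpr fun m hm => ?_
    simpa only [kronExponent_apply_of_ne hac.symm hbc.symm] using
      monomial_le_degreeOf c (mem_h₁ m hm)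
  have hE : g₁.degreeOf c + 1 ≤ (h.degreeOf c + 1) * (h.degreeOf b + 1) := by
    suffices g₁.degreeOf c ≤ h.degreeOf c + (h.degreeOf c + 1) * h.degreeOf b by linarith
    refine degreeOf_le_iff.mpr fun e he => ?_
    rw [hg₁] at he
    obtain ⟨m, hm, rfl⟩ := exists_of_mem_support_singleKron he
    rw [kronExponent_apply_target hbc]
    gcongr
    · exact monomial_le_degreeOf c hm
    · exact monomial_le_degreeOf b hm
  refine degreeOf_le_iff.mpr fun e he => ?_
  rw [hg₂] at he
  obtain ⟨e', he', rfl⟩ := exists_of_mem_support_singleKron he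
  rw [hg₁] at he'
  obtain ⟨m, hm, rfl⟩ := exists_of_mem_support_singleKron he'
  have hmem : kronExponent b c (h₁.degreeOf c + 1) (kronExponent a b (h.degreeOf b + 1) m) ∈
      h₂.support :=
    hh₂ ▸ kronExponent_mem_support_singleKron hbc (Nat.lt_succ_self _) (mem_h₁ m hm)
  refine le_trans ?_ (monomial_le_degreeOf c hmem)
  rw [kronExponent_apply_target hac, kronExponent_apply_target hbc,
    kronExponent_apply_of_ne hab hac, kronExponent_apply_target hbc,
    kronExponent_apply_of_ne hac.symm hbc.symm, kronExponent_apply_target hab]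
  calc m c + (h.degreeOf c + 1) * m b + (g₁.degreeOf c + 1) * m a
      ≤ m c + (h.degreeOf c + 1) * m b + (h.degreeOf c + 1) * (h.degreeOf b + 1) * m a := by
        gcongr
    _ = m c + (h.degreeOf c + 1) * (m b + (h.degreeOf b + 1) * m a) := by ring
    _ ≤ m c + (h₁.degreeOf c + 1) * (m b + (h.degreeOf b + 1) * m a) := by gcongr
end

section
/- Let R be a commutative ring, n : ℕ, D : ℕ, and p : MvPolynomial (Fin n) R a nonzero multivariate polynomial with degreeOf i p < D for every i : Fin n. Then φ_D p ≠ 0 and natDegree (φ_D p) equals the maximum, over all exponent vectors v in the support of p, of ∑_{i : Fin n} v i * D^(i : ℕ). -/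
open MvPolynomial Polynomial

/-- Standard Kronecker substitution: sends `X i` to `x ^ (D ^ i)`. -/
noncomputable def kroneckerSubst (R : Type*) [CommRing R] (n D : ℕ) :
    MvPolynomial (Fin n) R →ₐ[R] Polynomial R :=
  MvPolynomial.aeval (fun i : Fin n => (Polynomial.X : Polynomial R) ^ (D ^ (i : ℕ)))

theorem sum_mul_pow_injOn (n D : ℕ) :
    Set.InjOn (fun v : Fin n →₀ ℕ => ∑ i : Fin n, v i * D ^ (i : ℕ)) {v | ∀ i, v i < D} := by
  intro v hv w hw h
  have key : (finFunctionFinEquiv fun i => (⟨v i, hv i⟩ : Fin D)) =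
      finFunctionFinEquiv fun i => (⟨w i, hw i⟩ : Fin D) :=
    Fin.ext (by simpa only [finFunctionFinEquiv_apply] using h)
  ext i
  exact congrArg Fin.val (congrFun (finFunctionFinEquiv.injective key) i)

theorem kroneckerSubst_eq_sum {R : Type*} [CommRing R] (n D : ℕ) (p : MvPolynomial (Fin n) R) :
    kroneckerSubst R n D p =
      ∑ v ∈ p.support, Polynomial.monomial (∑ i : Fin n, v i * D ^ (i : ℕ)) (p.coeff v) := by
  rw [kroneckerSubst, MvPolynomial.aeval_def, MvPolynomial.eval₂_eq']
  refine Finset.sum_congr rfl fun v _ => ?_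
  simp_rw [← pow_mul, Finset.prod_pow_eq_pow_sum, mul_comm (D ^ _)]
  exact Polynomial.C_mul_X_pow_eq_monomial

theorem coeff_kroneckerSubst {R : Type*} [CommRing R] {n D : ℕ} {p : MvPolynomial (Fin n) R}
    (hd : ∀ i : Fin n, p.degreeOf i < D) {v : Fin n →₀ ℕ} (hv : v ∈ p.support) :
    (kroneckerSubst R n D p).coeff (∑ i : Fin n, v i * D ^ (i : ℕ)) = p.coeff v := by
  have hlt : ∀ w ∈ p.support, ∀ i, w i < D := fun w hw i =>
    (MvPolynomial.monomial_le_degreeOf i hw).trans_lt (hd i)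
  rw [kroneckerSubst_eq_sum, Polynomial.finsetSum_coeff, Finset.sum_eq_single_of_mem v hv]
  · exact Polynomial.coeff_monomial_same _ _
  · intro w hw hne
    exact Polynomial.coeff_monomial_of_ne _ fun h =>
      hne (sum_mul_pow_injOn n D (hlt w hw) (hlt v hv) h.symm)

theorem stmt_15 {R : Type*} [CommRing R] (n D : ℕ)
    (p : MvPolynomial (Fin n) R) (hp : p ≠ 0)
    (hd : ∀ i : Fin n, p.degreeOf i < D) :
    kroneckerSubst R n D p ≠ 0 ∧
      (kroneckerSubst R n D p).natDegree =
        p.support.sup (fun v => ∑ i : Fin n, v i * D ^ (i : ℕ)) := by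
  have hcoeff : ∀ v ∈ p.support,
      (kroneckerSubst R n D p).coeff (∑ i : Fin n, v i * D ^ (i : ℕ)) ≠ 0 := fun v hv => by
    rw [coeff_kroneckerSubst hd hv]
    exact MvPolynomial.mem_support_iff.mp hv
  refine ⟨?_, le_antisymm ?_ (Finset.sup_le fun v hv =>
    Polynomial.le_natDegree_of_ne_zero (hcoeff v hv))⟩
  · obtain ⟨v, hv⟩ := MvPolynomial.support_nonempty.mpr hp
    intro h
    exact hcoeff v hv (by rw [h, Polynomial.coeff_zero])
  · rw [kroneckerSubst_eq_sum]
    exact Polynomial.natDegree_sum_le_of_forall_le _ _ fun v hv =>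
      (Polynomial.natDegree_monomial_le _).trans
        (Finset.le_sup (f := fun v : Fin n →₀ ℕ => ∑ i : Fin n, v i * D ^ (i : ℕ)) hv)
end
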